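/- The functional S²(φ) = inf{ (1/2)∫ ‖z‖² P(dz dy dt) : (φ, P) is a viable pair for Regime 2 with initial point x₀ } (with the infimum over the empty set equal to +∞) is lower semicontinuous on C([0,1]; ℝ^d): if φⁿ → φ uniformly on [0,1], then liminf_n S²(φⁿ) ≥ S²(φ). -/

import Mathlib

open MeasureTheory Matrix Filter

noncomputable section

/-- The control space `Z = ℝ^d`. -/
abbrev Ctrl (d : ℕ) := Fin d → ℝ

/-- The `d`-dimensional torus `𝕋^d = ℝ^d/ℤ^d`. -/
abbrev Torus (d : ℕ) := Fin d → AddCircle (1 : ℝ)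

/-- The time interval `[0,1]`. -/
abbrev I01 := Set.Icc (0 : ℝ) 1

/-- The space `ℝ^d × 𝕋^d × [0,1]` on which occupation measures live. -/
abbrev Spc (d : ℕ) := Ctrl d × Torus d × I01

/-- The canonical projection `ℝ^d → 𝕋^d`. -/
def torusProj (d : ℕ) (w : Fin d → ℝ) : Torus d := fun i => (w i : AddCircle (1 : ℝ))

/-- `λ₂(x,y,z) = γ b(x,y) + c(x,y) + σ(x,y) z`. -/
def lam2 {d : ℕ} (γ : ℝ) (b c : (Fin d → ℝ) → Torus d → Fin d → ℝ)
    (σ : (Fin d → ℝ) → Torus d → Matrix (Fin d) (Fin d) ℝ)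
    (x : Fin d → ℝ) (y : Torus d) (z : Ctrl d) : Fin d → ℝ :=
  fun i => γ * b x y i + c x y i + (σ x y).mulVec z i

/-- A function `F : ℝ^d → ℝ` is a `C²` representative of a test function on the torus
if it is twice continuously differentiable and `ℤ^d`-periodic. -/
def IsC2Periodic {d : ℕ} (F : (Fin d → ℝ) → ℝ) : Prop :=
  ContDiff ℝ 2 F ∧ ∀ (w : Fin d → ℝ) (m : Fin d → ℤ), F (w + fun i => (m i : ℝ)) = F w

/-- The generator `ℒ²_{z,x} f(y)`, expressed through a periodic representative
`F = f ∘ π` on `ℝ^d`: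
`ℒ²_{z,x}F(w) = λ₂(x, π w, z)·∇F(w) + (γ/2) Σ_{ij} (σσᵀ)_{ij}(x, π w) ∂²F(w)/∂w_i∂w_j`. -/
def gen2 {d : ℕ} (γ : ℝ) (b c : (Fin d → ℝ) → Torus d → Fin d → ℝ)
    (σ : (Fin d → ℝ) → Torus d → Matrix (Fin d) (Fin d) ℝ)
    (x : Fin d → ℝ) (z : Ctrl d) (F : (Fin d → ℝ) → ℝ) (w : Fin d → ℝ) : ℝ :=
  (∑ i, lam2 γ b c σ x (torusProj d w) z i * fderiv ℝ F w (Pi.single i 1)) +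
    (γ / 2) * ∑ i, ∑ j, (σ x (torusProj d w) * (σ x (torusProj d w))ᵀ) i j *
      fderiv ℝ (fun v => fderiv ℝ F v (Pi.single j 1)) w (Pi.single i 1)

/-- A pair `(ψ, P)`, with `ψ ∈ C([0,1]; ℝ^d)` and `P` a Borel probability measure on
`ℝ^d × 𝕋^d × [0,1]`, is *viable* (for Regime 2 with initial point `x₀`) if
`P` has finite second moment in `z`, `ψ_t = x₀ + ∫_{ℝ^d×𝕋^d×[0,t]} λ₂(ψ_s,y,z) dP`,
`∫_{ℝ^d×𝕋^d×[0,t]} ℒ²_{z,ψ_s} f(y) dP = 0` for every `f ∈ C²(𝕋^d)` and `t ∈ [0,1]`,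
and the last marginal of `P` is Lebesgue measure. -/
def IsViablePair {d : ℕ} (γ : ℝ) (x₀ : Fin d → ℝ)
    (b c : (Fin d → ℝ) → Torus d → Fin d → ℝ)
    (σ : (Fin d → ℝ) → Torus d → Matrix (Fin d) (Fin d) ℝ)
    (ψ : C(I01, Fin d → ℝ)) (P : Measure (Spc d)) : Prop :=
  IsProbabilityMeasure P ∧
  Integrable (fun p : Spc d => ∑ i, (p.1 i) ^ 2) P ∧
  (∀ t : I01, ψ t = fun i => x₀ i +
      ∫ p in {p : Spc d | (p.2.2 : ℝ) ≤ (t : ℝ)}, lam2 γ b c σ (ψ p.2.2) p.2.1 p.1 i ∂P) ∧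
  (∀ F : (Fin d → ℝ) → ℝ, IsC2Periodic F →
    ∀ g : Spc d → ℝ,
      (∀ (z : Ctrl d) (w : Fin d → ℝ) (s : I01), g (z, torusProj d w, s) = gen2 γ b c σ (ψ s) z F w) →
      ∀ t : I01, ∫ p in {p : Spc d | (p.2.2 : ℝ) ≤ (t : ℝ)}, g p ∂P = 0) ∧
  (∀ t : I01, P {p : Spc d | (p.2.2 : ℝ) ≤ (t : ℝ)} = ENNReal.ofReal t)

end

/-- The rate functional
`S²(φ) = inf { (1/2)∫‖z‖² dP : (φ,P) viable for Regime 2 with initial point x₀ }`,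
with the infimum over the empty set equal to `+∞`. -/
noncomputable def S2 {d : ℕ} (γ : ℝ) (x₀ : Fin d → ℝ)
    (b c : (Fin d → ℝ) → Torus d → Fin d → ℝ)
    (σ : (Fin d → ℝ) → Torus d → Matrix (Fin d) (Fin d) ℝ)
    (φ : C(I01, Fin d → ℝ)) : ENNReal :=
  ⨅ (P : Measure (Spc d)) (_ : IsViablePair γ x₀ b c σ φ P),
    ENNReal.ofReal ((1 / 2) * ∫ p, ∑ i, (p.1 i) ^ 2 ∂P)

open scoped Topology BoundedContinuousFunction

section WeakLimits

variable {Ω T ι : Type*} [TopologicalSpace Ω] [MeasurableSpace Ω] [BorelSpace Ω]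

/-- A uniform bound on the integrals of a nonnegative continuous function passes to weak limits. -/
lemma integrable_and_integral_le_of_tendsto {F : Filter ι} [F.NeBot]
    {μs : ι → ProbabilityMeasure Ω} {μ : ProbabilityMeasure Ω} (hμ : Tendsto μs F (𝓝 μ))
    {V : Ω → ℝ} (hV : Continuous V) (hV0 : ∀ x, 0 ≤ V x) {K : ℝ}
    (hint : ∀ n, Integrable V (μs n : Measure Ω)) (hK : ∀ n, ∫ x, V x ∂(μs n : Measure Ω) ≤ K) :
    Integrable V (μ : Measure Ω) ∧ ∫ x, V x ∂(μ : Measure Ω) ≤ K := by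
  have hK0 : 0 ≤ K := by
    obtain ⟨n⟩ := F.nonempty_of_neBot
    exact (integral_nonneg hV0).trans (hK n)
  have htrunc (N : ℕ) : ∫⁻ x, ENNReal.ofReal (min (V x) N) ∂(μ : Measure Ω) ≤ ENNReal.ofReal K := by
    have hnn : ∀ x, 0 ≤ min (V x) N := fun x => le_min (hV0 x) N.cast_nonneg
    let f : Ω →ᵇ ℝ := BoundedContinuousFunction.ofNormedAddCommGroup (fun x => min (V x) N)
      (by fun_prop) N fun x => by
        rw [Real.norm_of_nonneg (hnn x)]
        exact min_le_right _ _
    change ∫⁻ x, ENNReal.ofReal (f x) ∂(μ : Measure Ω) ≤ ENNReal.ofReal K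
    rw [← ofReal_integral_eq_lintegral_ofReal (f.integrable (μ : Measure Ω))
      (Eventually.of_forall hnn)]
    refine ENNReal.ofReal_le_ofReal (le_of_tendsto'
      (ProbabilityMeasure.tendsto_iff_forall_integral_tendsto.1 hμ f) fun n => ?_)
    exact (integral_mono (f.integrable _) (hint n) fun x => min_le_left _ _).trans (hK n)
  have hlim : Tendsto (fun N : ℕ => ∫⁻ x, ENNReal.ofReal (min (V x) N) ∂(μ : Measure Ω)) atTop
      (𝓝 (∫⁻ x, ENNReal.ofReal (V x) ∂(μ : Measure Ω))) := by
    refine lintegral_tendsto_of_tendsto_of_monotone (fun N => ?_) ?_ ?_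
    · exact (hV.min continuous_const).measurable.ennreal_ofReal.aemeasurable
    · refine Eventually.of_forall fun x N M hNM => ENNReal.ofReal_le_ofReal ?_
      exact min_le_min_left _ (Nat.cast_le.2 hNM)
    · refine Eventually.of_forall fun x => tendsto_const_nhds.congr' ?_
      obtain ⟨N, hN⟩ := exists_nat_ge (V x)
      filter_upwards [eventually_ge_atTop N] with M hM
      rw [min_eq_left (hN.trans (Nat.cast_le.2 hM))]
  have hle := le_of_tendsto' hlim htrunc
  have hI : Integrable V (μ : Measure Ω) :=
    (lintegral_ofReal_ne_top_iff_integrable hV.measurable.aestronglyMeasurable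
      (Eventually.of_forall hV0)).1 (hle.trans_lt ENNReal.ofReal_lt_top).ne
  refine ⟨hI, ?_⟩
  rwa [← ofReal_integral_eq_lintegral_ofReal hI (Eventually.of_forall hV0),
    ENNReal.ofReal_le_ofReal_iff hK0] at hle

lemma abs_sub_clamp_le {h N : ℝ} (hN : 0 < N) : |h - max (-N) (min h N)| ≤ h ^ 2 / N := by
  rw [le_div_iff₀ hN]
  rcases le_total h N with h1 | h1
  · rcases le_total (-N) h with h2 | h2
    · rw [min_eq_left h1, max_eq_right h2]
      simpa using sq_nonneg h
    · rw [min_eq_left h1, max_eq_left h2, abs_of_nonpos (by linarith)]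
      nlinarith [sq_nonneg (h + N)]
  · rw [min_eq_right h1, max_eq_right (by linarith), abs_of_nonneg (by linarith)]
    nlinarith [sq_nonneg (h - N)]

lemma abs_clamp_le {h N : ℝ} (hN : 0 < N) : |max (-N) (min h N)| ≤ N :=
  abs_le.2 ⟨le_max_left _ _, max_le (by linarith) (min_le_right _ _)⟩

variable [TopologicalSpace T] [MeasurableSpace T] [BorelSpace T]

/-- Replacing `h` on `τ ⁻¹' S` by a clamped, continuously localised version costs little in `L¹`. -/
lemma abs_setIntegral_sub_integral_clamp_le {μ : Measure Ω} [IsProbabilityMeasure μ]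
    {τ : Ω → T} (hτ : Continuous τ) {S : Set T} (hS : MeasurableSet S)
    {h : Ω → ℝ} (hh : Continuous h) (h2 : Integrable (fun x => h x ^ 2) μ)
    {K : ℝ} (hK : ∫ x, h x ^ 2 ∂μ ≤ K) (ρ : T →ᵇ ℝ) {N : ℝ} (hN : 0 < N) {ε : ℝ}
    (hρ : ∫ s, ‖S.indicator 1 s - ρ s‖ ∂(μ.map τ) ≤ ε) :
    |∫ x in τ ⁻¹' S, h x ∂μ - ∫ x, ρ (τ x) * max (-N) (min (h x) N) ∂μ| ≤ K / N + N * ε := by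
  have hτm := hτ.measurable
  have hprob : IsProbabilityMeasure (μ.map τ) := Measure.isProbabilityMeasure_map hτm.aemeasurable
  have hL2 : MemLp h 2 μ := (memLp_two_iff_integrable_sq hh.aestronglyMeasurable).2 h2
  have hint : Integrable h μ := hL2.integrable one_le_two
  let f : Ω →ᵇ ℝ := BoundedContinuousFunction.ofNormedAddCommGroup
    (fun x => ρ (τ x) * max (-N) (min (h x) N)) (by fun_prop) (‖ρ‖ * N) fun x => by
      rw [norm_mul]
      exact mul_le_mul (ρ.norm_coe_le_norm _) (abs_clamp_le hN) (norm_nonneg _) (norm_nonneg _)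
  have hf : Integrable (fun x => ρ (τ x) * max (-N) (min (h x) N)) μ := f.integrable μ
  have hSτ : MeasurableSet (τ ⁻¹' S) := hτm hS
  have hdiff : Integrable (fun s => ‖S.indicator (1 : T → ℝ) s - ρ s‖) (μ.map τ) :=
    (((integrable_const (1 : ℝ)).indicator hS).sub (ρ.integrable _)).norm
  have hdiff' : Integrable (fun x => ‖S.indicator (1 : T → ℝ) (τ x) - ρ (τ x)‖) μ :=
    (integrable_map_measure hdiff.aestronglyMeasurable hτm.aemeasurable).1 hdiff
  rw [integral_map hτm.aemeasurable hdiff.aestronglyMeasurable] at hρ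
  rw [← integral_indicator hSτ, ← integral_sub (hint.indicator hSτ) hf]
  calc |∫ x, (τ ⁻¹' S).indicator h x - ρ (τ x) * max (-N) (min (h x) N) ∂μ|
      ≤ ∫ x, (h x ^ 2 / N + N * ‖S.indicator (1 : T → ℝ) (τ x) - ρ (τ x)‖) ∂μ := by
        rw [← Real.norm_eq_abs]
        refine norm_integral_le_of_norm_le ((h2.div_const N).add (hdiff'.const_mul N))
          (Eventually.of_forall fun x => ?_)
        have hsplit : (τ ⁻¹' S).indicator h x - ρ (τ x) * max (-N) (min (h x) N) =
            S.indicator (1 : T → ℝ) (τ x) * (h x - max (-N) (min (h x) N)) +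
              max (-N) (min (h x) N) * (S.indicator (1 : T → ℝ) (τ x) - ρ (τ x)) := by
          by_cases hx : τ x ∈ S
          · simp only [Set.indicator_of_mem hx, Set.indicator_of_mem (show x ∈ τ ⁻¹' S from hx),
              Pi.one_apply]
            ring
          · simp only [Set.indicator_of_notMem hx,
              Set.indicator_of_notMem (show x ∉ τ ⁻¹' S from hx)]
            ring
        rw [hsplit]
        refine (norm_add_le _ _).trans (add_le_add ?_ ?_)
        · rw [norm_mul]
          refine (mul_le_of_le_one_left (norm_nonneg _) ?_).trans (abs_sub_clamp_le hN)
          by_cases hx : τ x ∈ S <;> simp [hx]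
        · rw [norm_mul]
          exact mul_le_mul_of_nonneg_right (abs_clamp_le hN) (norm_nonneg _)
    _ = (∫ x, h x ^ 2 ∂μ) / N + N * ∫ x, ‖S.indicator (1 : T → ℝ) (τ x) - ρ (τ x)‖ ∂μ := by
        rw [integral_add (h2.div_const N) (hdiff'.const_mul N), integral_div, integral_const_mul]
    _ ≤ K / N + N * ε := by gcongr

/-- Weak convergence with a fixed marginal `ν` under `τ` allows integration over `τ ⁻¹' S` for any
measurable `S`, of any continuous function that is bounded in `L²`. -/
lemma tendsto_setIntegral_preimage_of_map_eq [NormalSpace T] [R1Space T] {F : Filter ι}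
    {μs : ι → ProbabilityMeasure Ω} {μ : ProbabilityMeasure Ω} (hμ : Tendsto μs F (𝓝 μ))
    {τ : Ω → T} (hτ : Continuous τ) {ν : Measure T} [IsFiniteMeasure ν] [ν.WeaklyRegular]
    (hν : ∀ n, (μs n : Measure Ω).map τ = ν) (hν' : (μ : Measure Ω).map τ = ν)
    {S : Set T} (hS : MeasurableSet S) {h : Ω → ℝ} (hh : Continuous h) {K : ℝ}
    (h2 : ∀ n, Integrable (fun x => h x ^ 2) (μs n : Measure Ω))
    (hK : ∀ n, ∫ x, h x ^ 2 ∂(μs n : Measure Ω) ≤ K)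
    (h2' : Integrable (fun x => h x ^ 2) (μ : Measure Ω))
    (hK' : ∫ x, h x ^ 2 ∂(μ : Measure Ω) ≤ K) :
    Tendsto (fun n => ∫ x in τ ⁻¹' S, h x ∂(μs n : Measure Ω)) F
      (𝓝 (∫ x in τ ⁻¹' S, h x ∂(μ : Measure Ω))) := by
  rw [Metric.tendsto_nhds]
  intro ε hε
  have hK0 : 0 ≤ K := (integral_nonneg fun x => sq_nonneg (h x)).trans hK'
  obtain ⟨N, hN, hKN⟩ : ∃ N : ℝ, 0 < N ∧ K / N < ε / 5 := by
    refine ⟨(K + 1) * 5 / ε, by positivity, ?_⟩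
    rw [div_lt_iff₀ (by positivity)]
    field_simp
    linarith
  have hδ : 0 < ε / (5 * N) := by positivity
  obtain ⟨ρ, hρ, -⟩ := Integrable.exists_boundedContinuous_integral_sub_le
    ((integrable_const (μ := ν) (1 : ℝ)).indicator hS) hδ
  have hNδ : N * (ε / (5 * N)) = ε / 5 := by field_simp
  let f : Ω →ᵇ ℝ := BoundedContinuousFunction.ofNormedAddCommGroup
    (fun x => ρ (τ x) * max (-N) (min (h x) N)) (by fun_prop) (‖ρ‖ * N) fun x => by
      rw [norm_mul]
      exact mul_le_mul (ρ.norm_coe_le_norm _) (abs_clamp_le hN) (norm_nonneg _) (norm_nonneg _)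
  have hlim := Metric.tendsto_nhds.1
    (ProbabilityMeasure.tendsto_iff_forall_integral_tendsto.1 hμ f) (ε / 5) (by positivity)
  filter_upwards [hlim] with n hn
  have e1 := abs_setIntegral_sub_integral_clamp_le hτ hS hh (h2 n) (hK n) ρ hN
    (ε := ε / (5 * N)) (by rw [hν n]; exact hρ)
  have e2 := abs_setIntegral_sub_integral_clamp_le hτ hS hh h2' hK' ρ hN
    (ε := ε / (5 * N)) (by rw [hν']; exact hρ)
  rw [hNδ] at e1 e2
  rw [Real.dist_eq, abs_lt] at hn ⊢
  rw [abs_le] at e1 e2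
  change _ < ∫ x, ρ (τ x) * max (-N) (min (h x) N) ∂(μs n : Measure Ω) -
    ∫ x, ρ (τ x) * max (-N) (min (h x) N) ∂(μ : Measure Ω) ∧
    ∫ x, ρ (τ x) * max (-N) (min (h x) N) ∂(μs n : Measure Ω) -
    ∫ x, ρ (τ x) * max (-N) (min (h x) N) ∂(μ : Measure Ω) < _ at hn
  constructor <;> linarith [hn.1, hn.2, e1.1, e1.2, e2.1, e2.2]

end WeakLimits

section Torus

lemma isOpenQuotientMap_torusProj (d : ℕ) : IsOpenQuotientMap (torusProj d) :=
  IsOpenQuotientMap.piMap fun _ => QuotientAddGroup.isOpenQuotientMap_mk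

lemma exists_eq_add_of_torusProj_eq {d : ℕ} {w w' : Fin d → ℝ}
    (h : torusProj d w = torusProj d w') : ∃ m : Fin d → ℤ, w = w' + fun i => (m i : ℝ) := by
  have (i : Fin d) : ∃ m : ℤ, w i = w' i + m := by
    have h0 : ((w i - w' i : ℝ) : AddCircle (1 : ℝ)) = 0 := by
      rw [AddCircle.coe_sub, sub_eq_zero]
      exact congrFun h i
    obtain ⟨m, hm⟩ := (AddCircle.coe_eq_zero_iff (1 : ℝ)).1 h0
    refine ⟨m, ?_⟩
    rw [zsmul_one] at hm
    linarith
  choose m hm using this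
  exact ⟨m, funext hm⟩

/-- A continuous periodic function descends to the torus. -/
lemma exists_continuous_comp_torusProj {d : ℕ} {f : (Fin d → ℝ) → ℝ} (hf : Continuous f)
    (hper : ∀ (w : Fin d → ℝ) (m : Fin d → ℤ), f (w + fun i => (m i : ℝ)) = f w) :
    ∃ G : Torus d → ℝ, Continuous G ∧ ∀ w, G (torusProj d w) = f w := by
  have hq := isOpenQuotientMap_torusProj d
  have hG (w : Fin d → ℝ) : f (Function.surjInv hq.surjective (torusProj d w)) = f w := by
    obtain ⟨m, hm⟩ := exists_eq_add_of_torusProj_eq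
      (Function.surjInv_eq hq.surjective (torusProj d w))
    rw [hm, hper]
  refine ⟨fun y => f (Function.surjInv hq.surjective y), ?_, hG⟩
  rw [← hq.continuous_comp_iff]
  exact hf.congr fun w => (hG w).symm

lemma continuous_uncurry_of_comp_torusProj {d : ℕ} {a : (Fin d → ℝ) → Torus d → ℝ}
    (h : Continuous fun p : (Fin d → ℝ) × (Fin d → ℝ) => a p.1 (torusProj d p.2)) :
    Continuous fun p : (Fin d → ℝ) × Torus d => a p.1 p.2 :=
  (IsOpenQuotientMap.id.prodMap (isOpenQuotientMap_torusProj d)).continuous_comp_iff.1 h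

lemma fderiv_apply_periodic {d : ℕ} {F : (Fin d → ℝ) → ℝ}
    (hper : ∀ (w : Fin d → ℝ) (m : Fin d → ℤ), F (w + fun i => (m i : ℝ)) = F w)
    (v w : Fin d → ℝ) (m : Fin d → ℤ) :
    fderiv ℝ F (w + fun i => (m i : ℝ)) v = fderiv ℝ F w v := by
  rw [← fderiv_comp_add_right, funext fun w => hper w m]

end Torus

section OccupationMeasures

variable {d : ℕ} {ι : Type*}

lemma continuous_coeff_mul {ζ : Ctrl d → ℝ} (hζ : Continuous ζ) (a : C(I01 × Torus d, ℝ)) :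
    Continuous fun p : Spc d => a (p.2.2, p.2.1) * ζ p.1 := by
  fun_prop

lemma integrable_coeff_mul {m : Measure (Spc d)} [IsFiniteMeasure m]
    (h2 : Integrable (fun p : Spc d => ∑ i, p.1 i ^ 2) m)
    {ζ : Ctrl d → ℝ} (hζ : Continuous ζ) (hζ2 : ∀ z, ζ z ^ 2 ≤ 1 + ∑ i, z i ^ 2)
    (a : C(I01 × Torus d, ℝ)) :
    Integrable (fun p : Spc d => a (p.2.2, p.2.1) * ζ p.1) m := by
  refine (((integrable_const (2 : ℝ)).add h2).const_mul ‖a‖).mono'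
    (continuous_coeff_mul hζ a).aestronglyMeasurable (Eventually.of_forall fun p => ?_)
  rw [norm_mul, Real.norm_eq_abs (ζ p.1)]
  refine mul_le_mul (a.norm_coe_le_norm _) ?_ (abs_nonneg _) (norm_nonneg _)
  simp only [Pi.add_apply]
  nlinarith [hζ2 p.1, sq_abs (ζ p.1), sq_nonneg (|ζ p.1| - 1)]

lemma abs_setIntegral_coeff_mul_le {m : Measure (Spc d)} [IsProbabilityMeasure m] {K : ℝ}
    (h2 : Integrable (fun p : Spc d => ∑ i, p.1 i ^ 2) m)
    (hK : ∫ p : Spc d, ∑ i, p.1 i ^ 2 ∂m ≤ K)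
    {ζ : Ctrl d → ℝ} (hζ : Continuous ζ) (hζ2 : ∀ z, ζ z ^ 2 ≤ 1 + ∑ i, z i ^ 2)
    (a : C(I01 × Torus d, ℝ)) (S : Set (Spc d)) :
    |∫ p in S, a (p.2.2, p.2.1) * ζ p.1 ∂m| ≤ ‖a‖ * (2 + K) := by
  have hi := integrable_coeff_mul h2 hζ hζ2 a
  calc |∫ p in S, a (p.2.2, p.2.1) * ζ p.1 ∂m|
      ≤ ∫ p in S, ‖a (p.2.2, p.2.1) * ζ p.1‖ ∂m := by
        rw [← Real.norm_eq_abs]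
        exact norm_integral_le_integral_norm _
    _ ≤ ∫ p, ‖a (p.2.2, p.2.1) * ζ p.1‖ ∂m :=
        setIntegral_le_integral hi.norm (Eventually.of_forall fun _ => norm_nonneg _)
    _ ≤ ∫ p : Spc d, ‖a‖ * (2 + ∑ i, p.1 i ^ 2) ∂m := by
        refine integral_mono hi.norm (((integrable_const (2 : ℝ)).add h2).const_mul ‖a‖)
          fun p => ?_
        simp only [norm_mul, Real.norm_eq_abs (ζ p.1)]
        refine mul_le_mul (a.norm_coe_le_norm _) ?_ (abs_nonneg _) (norm_nonneg _)
        nlinarith [hζ2 p.1, sq_abs (ζ p.1), sq_nonneg (|ζ p.1| - 1)]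
    _ = ‖a‖ * (2 + ∫ p : Spc d, ∑ i, p.1 i ^ 2 ∂m) := by
        rw [integral_const_mul, integral_add (integrable_const _) h2]
        simp
    _ ≤ ‖a‖ * (2 + K) := by gcongr

lemma integrable_coeff_mul_sq {m : Measure (Spc d)} [IsProbabilityMeasure m] {K : ℝ}
    (h2 : Integrable (fun p : Spc d => ∑ i, p.1 i ^ 2) m)
    (hK : ∫ p : Spc d, ∑ i, p.1 i ^ 2 ∂m ≤ K)
    {ζ : Ctrl d → ℝ} (hζ : Continuous ζ) (hζ2 : ∀ z, ζ z ^ 2 ≤ 1 + ∑ i, z i ^ 2)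
    (a : C(I01 × Torus d, ℝ)) :
    Integrable (fun p : Spc d => (a (p.2.2, p.2.1) * ζ p.1) ^ 2) m ∧
      ∫ p : Spc d, (a (p.2.2, p.2.1) * ζ p.1) ^ 2 ∂m ≤ ‖a‖ ^ 2 * (1 + K) := by
  have hle (p : Spc d) : (a (p.2.2, p.2.1) * ζ p.1) ^ 2 ≤ ‖a‖ ^ 2 * (1 + ∑ i, p.1 i ^ 2) := by
    rw [mul_pow]
    refine mul_le_mul ?_ (hζ2 p.1) (sq_nonneg _) (sq_nonneg _)
    rw [← sq_abs]
    exact pow_le_pow_left₀ (abs_nonneg _) (a.norm_coe_le_norm _) 2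
  have hdom : Integrable (fun p : Spc d => ‖a‖ ^ 2 * (1 + ∑ i, p.1 i ^ 2)) m :=
    ((integrable_const (1 : ℝ)).add h2).const_mul _
  have hi : Integrable (fun p : Spc d => (a (p.2.2, p.2.1) * ζ p.1) ^ 2) m :=
    hdom.mono' ((continuous_coeff_mul hζ a).pow 2).aestronglyMeasurable
      (Eventually.of_forall fun p => by
        rw [Real.norm_of_nonneg (sq_nonneg _)]
        exact hle p)
  refine ⟨hi, (integral_mono hi hdom hle).trans ?_⟩
  rw [integral_const_mul, integral_add (integrable_const _) h2]
  simp only [integral_const, probReal_univ, smul_eq_mul, mul_one]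
  gcongr

/-- A family of probability measures on `ℝ^d × 𝕋^d × [0,1]` converging weakly along `F`, with a
common time marginal and second moments in `z` bounded by `K`. -/
structure ConvergesWithBoundedMoment (F : Filter ι) (μs : ι → ProbabilityMeasure (Spc d))
    (μ : ProbabilityMeasure (Spc d)) (K : ℝ) : Prop where
  tendsto : Tendsto μs F (𝓝 μ)
  map_eq : ∀ n, (μs n : Measure (Spc d)).map (fun p => p.2.2) =
    (μ : Measure (Spc d)).map (fun p => p.2.2)
  integrable : ∀ n, Integrable (fun p : Spc d => ∑ i, p.1 i ^ 2) (μs n : Measure (Spc d))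
  integral_le : ∀ n, ∫ p : Spc d, ∑ i, p.1 i ^ 2 ∂(μs n : Measure (Spc d)) ≤ K
  integrable_lim : Integrable (fun p : Spc d => ∑ i, p.1 i ^ 2) (μ : Measure (Spc d))
  integral_lim_le : ∫ p : Spc d, ∑ i, p.1 i ^ 2 ∂(μ : Measure (Spc d)) ≤ K

namespace ConvergesWithBoundedMoment

variable {F : Filter ι} {μs : ι → ProbabilityMeasure (Spc d)} {μ : ProbabilityMeasure (Spc d)}
  {K : ℝ}

/-- Integrals of `a (s, y) ζ(z)` over `[0,t]` pass to the limit when the coefficient `a` converges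
uniformly and `ζ` is dominated in `L²` by the second moment in `z`. -/
lemma tendsto_setIntegral_coeff_mul (H : ConvergesWithBoundedMoment F μs μ K)
    {ζ : Ctrl d → ℝ} (hζ : Continuous ζ) (hζ2 : ∀ z, ζ z ^ 2 ≤ 1 + ∑ i, z i ^ 2)
    {as : ι → C(I01 × Torus d, ℝ)} {a : C(I01 × Torus d, ℝ)} (ha : Tendsto as F (𝓝 a))
    (t : I01) :
    Tendsto (fun n => ∫ p in {p : Spc d | (p.2.2 : ℝ) ≤ (t : ℝ)},
        as n (p.2.2, p.2.1) * ζ p.1 ∂(μs n : Measure (Spc d))) F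
      (𝓝 (∫ p in {p : Spc d | (p.2.2 : ℝ) ≤ (t : ℝ)},
        a (p.2.2, p.2.1) * ζ p.1 ∂(μ : Measure (Spc d)))) := by
  have hτ : Continuous fun p : Spc d => p.2.2 := by fun_prop
  have hprob : IsProbabilityMeasure ((μ : Measure (Spc d)).map fun p => p.2.2) :=
    Measure.isProbabilityMeasure_map hτ.measurable.aemeasurable
  have hfix : Tendsto (fun n => ∫ p in {p : Spc d | (p.2.2 : ℝ) ≤ (t : ℝ)},
        a (p.2.2, p.2.1) * ζ p.1 ∂(μs n : Measure (Spc d))) F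
      (𝓝 (∫ p in {p : Spc d | (p.2.2 : ℝ) ≤ (t : ℝ)},
        a (p.2.2, p.2.1) * ζ p.1 ∂(μ : Measure (Spc d)))) :=
    tendsto_setIntegral_preimage_of_map_eq H.tendsto hτ H.map_eq rfl
      (measurableSet_Iic (a := t)) (continuous_coeff_mul hζ a)
      (fun n => (integrable_coeff_mul_sq (H.integrable n) (H.integral_le n) hζ hζ2 a).1)
      (fun n => (integrable_coeff_mul_sq (H.integrable n) (H.integral_le n) hζ hζ2 a).2)
      (integrable_coeff_mul_sq H.integrable_lim H.integral_lim_le hζ hζ2 a).1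
      (integrable_coeff_mul_sq H.integrable_lim H.integral_lim_le hζ hζ2 a).2
  have hdiff : Tendsto (fun n => ∫ p in {p : Spc d | (p.2.2 : ℝ) ≤ (t : ℝ)},
      (as n - a) (p.2.2, p.2.1) * ζ p.1 ∂(μs n : Measure (Spc d))) F (𝓝 0) := by
    refine squeeze_zero_norm (fun n => abs_setIntegral_coeff_mul_le (H.integrable n)
      (H.integral_le n) hζ hζ2 (as n - a) _) ?_
    simpa using (tendsto_iff_norm_sub_tendsto_zero.1 ha).mul_const (2 + K)
  have hsum := hdiff.add hfix
  rw [zero_add] at hsum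
  refine hsum.congr fun n => ?_
  rw [← integral_add (integrable_coeff_mul (H.integrable n) hζ hζ2 _).integrableOn
    (integrable_coeff_mul (H.integrable n) hζ hζ2 _).integrableOn]
  refine integral_congr_ae (Eventually.of_forall fun p => ?_)
  simp only [ContinuousMap.sub_apply]
  ring

/-- Integrals over `[0,t]` of a function that is affine in `z`, with coefficients evaluated along
uniformly converging paths, pass to the limit. -/
lemma tendsto_setIntegral_affine (H : ConvergesWithBoundedMoment F μs μ K)
    {A : (Fin d → ℝ) → Torus d → ℝ} {B : Fin d → (Fin d → ℝ) → Torus d → ℝ}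
    (hA : Continuous fun q : (Fin d → ℝ) × Torus d => A q.1 q.2)
    (hB : ∀ k, Continuous fun q : (Fin d → ℝ) × Torus d => B k q.1 q.2)
    {φs : ι → C(I01, Fin d → ℝ)} {φ : C(I01, Fin d → ℝ)} (hφ : Tendsto φs F (𝓝 φ)) (t : I01) :
    Tendsto (fun n => ∫ p in {p : Spc d | (p.2.2 : ℝ) ≤ (t : ℝ)},
        (A (φs n p.2.2) p.2.1 + ∑ k, B k (φs n p.2.2) p.2.1 * p.1 k) ∂(μs n : Measure (Spc d))) F
      (𝓝 (∫ p in {p : Spc d | (p.2.2 : ℝ) ≤ (t : ℝ)},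
        (A (φ p.2.2) p.2.1 + ∑ k, B k (φ p.2.2) p.2.1 * p.1 k) ∂(μ : Measure (Spc d)))) := by
  let along (C : (Fin d → ℝ) → Torus d → ℝ)
      (hC : Continuous fun q : (Fin d → ℝ) × Torus d => C q.1 q.2) (ψ : C(I01, Fin d → ℝ)) :
      C(I01 × Torus d, ℝ) :=
    ⟨fun q => C (ψ q.1) q.2, hC.comp (by fun_prop : Continuous fun q : I01 × Torus d => (ψ q.1, q.2))⟩
  have halong C hC : Tendsto (fun n => along C hC (φs n)) F (𝓝 (along C hC φ)) := by
    refine Tendsto.comp (Continuous.tendsto ?_ φ) hφ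
    refine ContinuousMap.continuous_of_continuous_uncurry _ ?_
    exact hC.comp (by fun_prop :
      Continuous fun r : C(I01, Fin d → ℝ) × I01 × Torus d => (r.1 r.2.1, r.2.2))
  have hone (z : Ctrl d) : (1 : ℝ) ^ 2 ≤ 1 + ∑ i, z i ^ 2 := by
    have := Finset.sum_nonneg fun i (_ : i ∈ Finset.univ) => sq_nonneg (z i)
    linarith
  have hcoord (k : Fin d) (z : Ctrl d) : z k ^ 2 ≤ 1 + ∑ i, z i ^ 2 := by
    have := Finset.single_le_sum (f := fun i => z i ^ 2) (fun i _ => sq_nonneg (z i))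
      (Finset.mem_univ k)
    linarith
  have hsplit (ψ : C(I01, Fin d → ℝ)) (m : Measure (Spc d)) [IsProbabilityMeasure m]
      (h2 : Integrable (fun p : Spc d => ∑ i, p.1 i ^ 2) m) :
      ∫ p in {p : Spc d | (p.2.2 : ℝ) ≤ (t : ℝ)},
        (A (ψ p.2.2) p.2.1 + ∑ k, B k (ψ p.2.2) p.2.1 * p.1 k) ∂m =
      (∫ p in {p : Spc d | (p.2.2 : ℝ) ≤ (t : ℝ)}, along A hA ψ (p.2.2, p.2.1) * 1 ∂m) +
      ∑ k, ∫ p in {p : Spc d | (p.2.2 : ℝ) ≤ (t : ℝ)},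
        along (B k) (hB k) ψ (p.2.2, p.2.1) * p.1 k ∂m := by
    have hi (k : Fin d) := (integrable_coeff_mul h2 (continuous_apply k) (hcoord k)
      (along (B k) (hB k) ψ)).integrableOn (s := {p : Spc d | (p.2.2 : ℝ) ≤ (t : ℝ)})
    rw [← integral_finsetSum _ fun k _ => hi k, ← integral_add
      (integrable_coeff_mul h2 continuous_const hone (along A hA ψ)).integrableOn
      (integrable_finsetSum _ fun k _ => hi k)]
    refine integral_congr_ae (Eventually.of_forall fun p => ?_)
    simp [along]
  simp_rw [fun n => hsplit (φs n) _ (H.integrable n)]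
  rw [hsplit φ _ H.integrable_lim]
  exact (H.tendsto_setIntegral_coeff_mul continuous_const hone (halong A hA) t).add
    (tendsto_finsetSum _ fun k _ => H.tendsto_setIntegral_coeff_mul (continuous_apply k)
      (hcoord k) (halong (B k) (hB k)) t)

end ConvergesWithBoundedMoment

/-- A family of probability measures on `ℝ^d × 𝕋^d × [0,1]` with bounded second moments in `z` is
tight. -/
lemma isTightMeasureSet_of_integral_sq_le {S : Set (ProbabilityMeasure (Spc d))} {K : ℝ}
    (h2 : ∀ m ∈ S, Integrable (fun p : Spc d => ∑ i, p.1 i ^ 2) (m : Measure (Spc d)))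
    (hK : ∀ m ∈ S, ∫ p : Spc d, ∑ i, p.1 i ^ 2 ∂(m : Measure (Spc d)) ≤ K) :
    IsTightMeasureSet {x : Measure (Spc d) | ∃ m ∈ S, (m : Measure (Spc d)) = x} := by
  rw [isTightMeasureSet_iff_exists_isCompact_measure_compl_le]
  intro ε hε
  rcases eq_or_ne ε ⊤ with rfl | hε'
  · exact ⟨∅, isCompact_empty, fun _ _ => le_top⟩
  have hε0 : 0 < ε.toReal := ENNReal.toReal_pos hε.ne' hε'
  set R : ℝ := |K| / ε.toReal + 1 with hR
  have hR1 : 1 ≤ R := by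
    have : 0 ≤ |K| / ε.toReal := by positivity
    linarith
  refine ⟨Metric.closedBall 0 R ×ˢ Set.univ,
    (isCompact_closedBall _ _).prod isCompact_univ, ?_⟩
  rintro _ ⟨m, hm, rfl⟩
  have hsub : (Metric.closedBall (0 : Ctrl d) R ×ˢ (Set.univ : Set (Torus d × I01)))ᶜ ⊆
      {p : Spc d | R ^ 2 ≤ ∑ i, p.1 i ^ 2} := by
    intro p hp
    by_contra hlt
    refine hp ⟨?_, trivial⟩
    rw [mem_closedBall_zero_iff, pi_norm_le_iff_of_nonneg (by linarith)]
    intro i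
    refine abs_le_of_sq_le_sq ?_ (by linarith)
    exact (Finset.single_le_sum (f := fun i => p.1 i ^ 2) (fun i _ => sq_nonneg (p.1 i))
      (Finset.mem_univ i)).trans (not_le.1 hlt).le
  refine (measure_mono hsub).trans ?_
  rw [← ENNReal.ofReal_toReal (measure_ne_top (m : Measure (Spc d)) _)]
  refine ENNReal.ofReal_le_of_le_toReal ?_
  have hmarkov := (mul_meas_ge_le_integral_of_nonneg (Eventually.of_forall fun p : Spc d =>
    Finset.sum_nonneg fun i _ => sq_nonneg (p.1 i)) (h2 m hm) (R ^ 2)).trans (hK m hm)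
  have hKR : |K| ≤ ε.toReal * R ^ 2 := by
    have : ε.toReal * R = |K| + ε.toReal := by rw [hR]; field_simp
    have : ε.toReal * R ≤ ε.toReal * R ^ 2 :=
      mul_le_mul_of_nonneg_left (le_self_pow₀ hR1 two_ne_zero) hε0.le
    linarith
  refine le_of_mul_le_mul_left ?_ (by positivity : 0 < R ^ 2)
  calc _ ≤ K := hmarkov
    _ ≤ R ^ 2 * ε.toReal := by linarith [le_abs_self K]

lemma map_time_eq {m m' : Measure (Spc d)} [IsFiniteMeasure m]
    (h : ∀ t : I01, m {p : Spc d | (p.2.2 : ℝ) ≤ (t : ℝ)} = m' {p : Spc d | (p.2.2 : ℝ) ≤ (t : ℝ)}) :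
    m.map (fun p => p.2.2) = m'.map (fun p => p.2.2) := by
  have hτ : Measurable fun p : Spc d => p.2.2 := by fun_prop
  refine Measure.ext_of_Iic _ _ fun t => ?_
  rw [Measure.map_apply hτ measurableSet_Iic, Measure.map_apply hτ measurableSet_Iic]
  exact h t

/-- Compactness: occupation measures with Lebesgue time marginal and bounded second moments have a
limit along some finer ultrafilter. -/
lemma exists_convergesWithBoundedMoment {F : Filter ι} [F.NeBot]
    {μs : ι → ProbabilityMeasure (Spc d)} {K : ℝ}
    (h2 : ∀ n, Integrable (fun p : Spc d => ∑ i, p.1 i ^ 2) (μs n : Measure (Spc d)))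
    (hK : ∀ n, ∫ p : Spc d, ∑ i, p.1 i ^ 2 ∂(μs n : Measure (Spc d)) ≤ K)
    (htime : ∀ n, ∀ t : I01, (μs n : Measure (Spc d)) {p : Spc d | (p.2.2 : ℝ) ≤ (t : ℝ)} =
      ENNReal.ofReal t) :
    ∃ (U : Ultrafilter ι) (μ : ProbabilityMeasure (Spc d)),
      (U : Filter ι) ≤ F ∧ ConvergesWithBoundedMoment (U : Filter ι) μs μ K := by
  obtain ⟨μ, -, hμ⟩ := (isCompact_closure_of_isTightMeasureSet
    (isTightMeasureSet_of_integral_sq_le (S := Set.range μs) (K := K)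
      (by rintro _ ⟨n, rfl⟩; exact h2 n) (by rintro _ ⟨n, rfl⟩; exact hK n))).ultrafilter_le_nhds
    ((Ultrafilter.of F).map μs) (by
      rw [Ultrafilter.coe_map, le_principal_iff, mem_map]
      exact univ_mem' fun n => subset_closure ⟨n, rfl⟩)
  have hlim : Tendsto μs (Ultrafilter.of F : Filter ι) (𝓝 μ) := hμ
  have hV : Continuous fun p : Spc d => ∑ i, p.1 i ^ 2 := by fun_prop
  obtain ⟨h2', hK'⟩ := integrable_and_integral_le_of_tendsto hlim hV
    (fun p => Finset.sum_nonneg fun i _ => sq_nonneg (p.1 i)) h2 hK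
  have hτ : Continuous fun p : Spc d => p.2.2 := by fun_prop
  refine ⟨Ultrafilter.of F, μ, Ultrafilter.of_le F, hlim, fun n => ?_, h2, hK, h2', hK'⟩
  have hmap := ProbabilityMeasure.tendsto_map_of_tendsto_of_continuous μs μ hlim hτ
  have hconst : (fun k => (μs k).map hτ.measurable.aemeasurable) =
      fun _ => (μs n).map hτ.measurable.aemeasurable := by
    funext k
    refine Subtype.ext ?_
    exact map_time_eq fun t => by rw [htime, htime]
  rw [hconst] at hmap
  exact congrArg (fun m : ProbabilityMeasure I01 => (m : Measure I01))
    (tendsto_nhds_unique tendsto_const_nhds hmap)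

end OccupationMeasures

section Viability

variable {d : ℕ} {ι : Type*} {γ : ℝ} {b c : (Fin d → ℝ) → Torus d → Fin d → ℝ}
  {σ : (Fin d → ℝ) → Torus d → Matrix (Fin d) (Fin d) ℝ}

/-- The generator applied to a test function is affine in `z`, with continuous coefficients on
`ℝ^d × 𝕋^d`. -/
lemma exists_gen2_eq_affine
    (hb : ∀ i, Continuous fun q : (Fin d → ℝ) × Torus d => b q.1 q.2 i)
    (hc : ∀ i, Continuous fun q : (Fin d → ℝ) × Torus d => c q.1 q.2 i)
    (hσ : ∀ i j, Continuous fun q : (Fin d → ℝ) × Torus d => σ q.1 q.2 i j)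
    {F : (Fin d → ℝ) → ℝ} (hF : IsC2Periodic F) :
    ∃ (A : (Fin d → ℝ) → Torus d → ℝ) (B : Fin d → (Fin d → ℝ) → Torus d → ℝ),
      (Continuous fun q : (Fin d → ℝ) × Torus d => A q.1 q.2) ∧
      (∀ k, Continuous fun q : (Fin d → ℝ) × Torus d => B k q.1 q.2) ∧
      ∀ x z w, gen2 γ b c σ x z F w =
        A x (torusProj d w) + ∑ k, B k x (torusProj d w) * z k := by
  obtain ⟨hF2, hper⟩ := hF
  have hd1 (i : Fin d) : ContDiff ℝ 1 fun w => fderiv ℝ F w (Pi.single i 1) :=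
    (hF2.fderiv_right (m := 1) (by norm_num)).clm_apply contDiff_const
  have hd2 (i j : Fin d) : Continuous fun w =>
      fderiv ℝ (fun v => fderiv ℝ F v (Pi.single j 1)) w (Pi.single i 1) :=
    ((hd1 j).continuous_fderiv (by norm_num)).clm_apply continuous_const
  choose G hG hGw using fun i => exists_continuous_comp_torusProj (hd1 i).continuous
    fun w m => fderiv_apply_periodic hper _ w m
  choose H hH hHw using fun i j => exists_continuous_comp_torusProj (hd2 i j)
    fun w m => fderiv_apply_periodic (fun w m => fderiv_apply_periodic hper _ w m) _ w m
  refine ⟨fun x y => ∑ i, (γ * b x y i + c x y i) * G i y +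
      γ / 2 * ∑ i, ∑ j, (∑ k, σ x y i k * σ x y j k) * H i j y,
    fun k x y => ∑ i, σ x y i k * G i y, by fun_prop, by fun_prop, fun x z w => ?_⟩
  have hcross : ∑ k, (∑ i, σ x (torusProj d w) i k * G i (torusProj d w)) * z k =
      ∑ i, (σ x (torusProj d w)).mulVec z i * G i (torusProj d w) := by
    simp only [mulVec, dotProduct, Finset.sum_mul]
    rw [Finset.sum_comm]
    exact Finset.sum_congr rfl fun i _ => Finset.sum_congr rfl fun k _ => by ring
  rw [hcross]
  simp only [gen2, lam2, hGw, hHw, Matrix.mul_apply, Matrix.transpose_apply, add_mul,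
    Finset.sum_add_distrib]
  ring

/-- Viability passes to the limit. -/
lemma IsViablePair.of_tendsto {x₀ : Fin d → ℝ}
    (hb : ∀ i, Continuous fun q : (Fin d → ℝ) × Torus d => b q.1 q.2 i)
    (hc : ∀ i, Continuous fun q : (Fin d → ℝ) × Torus d => c q.1 q.2 i)
    (hσ : ∀ i j, Continuous fun q : (Fin d → ℝ) × Torus d => σ q.1 q.2 i j)
    {F : Filter ι} [F.NeBot] {φs : ι → C(I01, Fin d → ℝ)} {φ : C(I01, Fin d → ℝ)}
    (hφ : Tendsto φs F (𝓝 φ)) {μs : ι → ProbabilityMeasure (Spc d)}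
    {μ : ProbabilityMeasure (Spc d)} {K : ℝ} (H : ConvergesWithBoundedMoment F μs μ K)
    (hv : ∀ n, IsViablePair γ x₀ b c σ (φs n) (μs n : Measure (Spc d))) :
    IsViablePair γ x₀ b c σ φ (μ : Measure (Spc d)) := by
  refine ⟨inferInstance, H.integrable_lim, fun t => ?_, fun f hf g hg t => ?_, fun t => ?_⟩
  · funext i
    have hlam (x : Fin d → ℝ) (y : Torus d) (z : Ctrl d) : lam2 γ b c σ x y z i =
        (γ * b x y i + c x y i) + ∑ k, σ x y i k * z k := rfl
    have hlim := H.tendsto_setIntegral_affine (A := fun x y => γ * b x y i + c x y i)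
      (B := fun k x y => σ x y i k) (by fun_prop) (fun k => hσ i k) hφ t
    have hφt : Tendsto (fun n => φs n t i) F (𝓝 (φ t i)) :=
      Tendsto.comp ((by fun_prop : Continuous fun ψ : C(I01, Fin d → ℝ) => ψ t i).tendsto φ) hφ
    refine tendsto_nhds_unique hφt ((hlim.const_add (x₀ i)).congr fun n => ?_)
    exact (congrFun ((hv n).2.2.1 t) i).symm
  · obtain ⟨A, B, hA, hB, hAB⟩ := exists_gen2_eq_affine (γ := γ) hb hc hσ hf
    have hg' : g = fun p => A (φ p.2.2) p.2.1 + ∑ k, B k (φ p.2.2) p.2.1 * p.1 k := by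
      funext ⟨z, y, s⟩
      obtain ⟨w, rfl⟩ := (isOpenQuotientMap_torusProj d).surjective y
      rw [hg, hAB]
    rw [hg']
    refine tendsto_nhds_unique (H.tendsto_setIntegral_affine hA hB hφ t)
      (tendsto_const_nhds.congr fun n => ?_)
    exact ((hv n).2.2.2.1 f hf _ (fun z w s => (hAB _ _ _).symm) t).symm
  · obtain ⟨n⟩ := F.nonempty_of_neBot
    have hτ : Measurable fun p : Spc d => p.2.2 := by fun_prop
    have hIic := congrArg (fun m => m (Set.Iic t)) (H.map_eq n)
    simp only [Measure.map_apply hτ measurableSet_Iic] at hIic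
    exact hIic.symm.trans ((hv n).2.2.2.2 t)

end Viability

/-- **Lower semicontinuity of the Regime 2 rate functional.**
If `φⁿ → φ` uniformly on `[0,1]`, then `liminf_n S²(φⁿ) ≥ S²(φ)`. -/
theorem S2_lowerSemicontinuous {d : ℕ} (hd : 1 ≤ d) (γ : ℝ) (hγ : 0 < γ)
    (x₀ : Fin d → ℝ)
    (b c : (Fin d → ℝ) → Torus d → Fin d → ℝ)
    (σ : (Fin d → ℝ) → Torus d → Matrix (Fin d) (Fin d) ℝ)
    -- boundedness of the coefficients
    (hbB : ∃ M, ∀ x y i, |b x y i| ≤ M) (hcB : ∃ M, ∀ x y i, |c x y i| ≤ M)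
    (hσB : ∃ M, ∀ x y i j, |σ x y i j| ≤ M)
    -- Lipschitz continuity of the coefficients (via periodic representatives)
    (hbL : ∃ L : NNReal, ∀ i, LipschitzWith L
      (fun p : (Fin d → ℝ) × (Fin d → ℝ) => b p.1 (torusProj d p.2) i))
    (hcL : ∃ L : NNReal, ∀ i, LipschitzWith L
      (fun p : (Fin d → ℝ) × (Fin d → ℝ) => c p.1 (torusProj d p.2) i))
    (hσL : ∃ L : NNReal, ∀ i j, LipschitzWith L
      (fun p : (Fin d → ℝ) × (Fin d → ℝ) => σ p.1 (torusProj d p.2) i j))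
    -- uniform nondegeneracy of `σσᵀ`
    (hnd : ∃ θ > (0 : ℝ), ∀ x y (ξ : Fin d → ℝ),
      θ * ∑ i, (ξ i) ^ 2 ≤ ξ ⬝ᵥ (σ x y * (σ x y)ᵀ).mulVec ξ)
    (φs : ℕ → C(I01, Fin d → ℝ)) (φ : C(I01, Fin d → ℝ))
    (hφ : TendstoUniformly (fun n => ⇑(φs n)) (⇑φ) Filter.atTop) :
    S2 γ x₀ b c σ φ ≤ Filter.liminf (fun n => S2 γ x₀ b c σ (φs n)) Filter.atTop := by
  obtain ⟨L, hbL⟩ := hbL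
  obtain ⟨L', hcL⟩ := hcL
  obtain ⟨L'', hσL⟩ := hσL
  have hb i := continuous_uncurry_of_comp_torusProj (a := fun x y => b x y i) (hbL i).continuous
  have hc i := continuous_uncurry_of_comp_torusProj (a := fun x y => c x y i) (hcL i).continuous
  have hσ i j :=
    continuous_uncurry_of_comp_torusProj (a := fun x y => σ x y i j) (hσL i j).continuous
  by_contra! hlt
  obtain ⟨a, ha, haφ⟩ := exists_between hlt
  obtain ⟨ns, hns, hns_lt⟩ := extraction_of_frequently_atTop (frequently_lt_of_liminf_lt
    (by isBoundedDefault) ha)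
  simp only [S2, iInf_lt_iff] at hns_lt
  choose P hP hPa using hns_lt
  let μs : ℕ → ProbabilityMeasure (Spc d) := fun n => ⟨P n, (hP n).1⟩
  have hK (n : ℕ) : ∫ p : Spc d, ∑ i, p.1 i ^ 2 ∂(μs n : Measure (Spc d)) ≤ 2 * a.toReal := by
    have h0 : 0 ≤ ∫ p : Spc d, ∑ i, p.1 i ^ 2 ∂(P n) :=
      integral_nonneg fun p => Finset.sum_nonneg fun i _ => sq_nonneg (p.1 i)
    have := (ENNReal.ofReal_lt_iff_lt_toReal (by positivity) haφ.ne_top).1 (hPa n)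
    change ∫ p : Spc d, ∑ i, p.1 i ^ 2 ∂(P n) ≤ 2 * a.toReal
    linarith
  obtain ⟨U, μ, hU, H⟩ := exists_convergesWithBoundedMoment (F := atTop) (μs := μs)
    (fun n => (hP n).2.1) hK fun n => (hP n).2.2.2.2
  have hφU : Tendsto (fun n => φs (ns n)) (U : Filter ℕ) (𝓝 φ) :=
    ((ContinuousMap.tendsto_iff_tendstoUniformly.2 hφ).comp hns.tendsto_atTop).mono_left hU
  refine haφ.not_ge ((iInf₂_le _ (IsViablePair.of_tendsto hb hc hσ hφU H hP)).trans ?_)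
  exact ENNReal.ofReal_le_of_le_toReal (by linarith [H.integral_lim_le])
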